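/- Let X ∈ R^p have a multivariate Gaussian distribution N(0, Σ) with Σ positive definite, and let s ∈ R^p be a nonnegative vector such that 2Σ - diag(s) is positive semidefinite. Define X̃ | X ~ N(μ(X), V) with μ(X) = X - diag(s) Σ^{-1} X and V = 2 diag(s) - diag(s) Σ^{-1} diag(s). Then the joint vector (X, X̃) ∈ R^{2p} is Gaussian with covariance G = [[Σ, Σ - diag(s)], [Σ - diag(s), Σ]], and for every S ⊆ {1,...,p}, (X, X̃)_{swap(S)} is equal in distribution to (X, X̃). -/

import Mathlib

open MeasureTheory ProbabilityTheory Matrix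
open scoped Classical


lemma gk_dot {p : ℕ} (M : Matrix (Fin p) (Fin p) ℝ) (a b : Fin p → ℝ) :
    ∑ i, ∑ j, a i * M i j * b j = a ⬝ᵥ M *ᵥ b := by
  simp only [dotProduct, mulVec, Finset.mul_sum, mul_assoc]

lemma gk_symm {p : ℕ} (M : Matrix (Fin p) (Fin p) ℝ) (hM : Mᵀ = M) (a b : Fin p → ℝ) :
    a ⬝ᵥ M *ᵥ b = b ⬝ᵥ M *ᵥ a := by
  rw [dotProduct_mulVec, ← mulVec_transpose, hM, dotProduct_comm]

lemma gk_quad {p : ℕ} (Sig : Matrix (Fin p) (Fin p) ℝ) (hS : Sigᵀ = Sig)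
    (s a b : Fin p → ℝ) :
    ∑ i, ∑ j, a i * Sig i j * a j +
            2 * ∑ i, ∑ j, a i * (Sig - Matrix.diagonal s) i j * b j +
            ∑ i, ∑ j, b i * Sig i j * b j =
    (a + b) ⬝ᵥ Sig *ᵥ (a + b) - 2 * (a ⬝ᵥ Matrix.diagonal s *ᵥ b) := by
  simp only [gk_dot, mulVec_add, dotProduct_add, add_dotProduct, sub_mulVec, dotProduct_sub]
  rw [gk_symm Sig hS b a]
  ring

lemma gk_V {p : ℕ} (Sig : Matrix (Fin p) (Fin p) ℝ) (hSig : Sig.PosDef)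
    (s : Fin p → ℝ) (hs : ∀ i, 0 ≤ s i)
    (hpsd : ((2 : ℝ) • Sig - Matrix.diagonal s).PosSemidef) (a b : Fin p → ℝ) :
    0 ≤ b ⬝ᵥ ((2 : ℝ) • Matrix.diagonal s -
              Matrix.diagonal s * Sig⁻¹ * Matrix.diagonal s) *ᵥ b ∧
    (a + b - (Sig⁻¹ * Matrix.diagonal s) *ᵥ b) ⬝ᵥ Sig *ᵥ
      (a + b - (Sig⁻¹ * Matrix.diagonal s) *ᵥ b) +
     b ⬝ᵥ ((2 : ℝ) • Matrix.diagonal s -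
              Matrix.diagonal s * Sig⁻¹ * Matrix.diagonal s) *ᵥ b =
     (a + b) ⬝ᵥ Sig *ᵥ (a + b) - 2 * (a ⬝ᵥ Matrix.diagonal s *ᵥ b) := by
  have hS : Sigᵀ = Sig := by
    have h : Sigᴴ = Sig := hSig.1
    rwa [conjTranspose_eq_transpose_of_trivial] at h
  have hD : (Matrix.diagonal s)ᵀ = Matrix.diagonal s := by simp
  have hu : IsUnit Sig.det := (Matrix.isUnit_iff_isUnit_det _).1 hSig.isUnit
  set D := Matrix.diagonal s with hDdef
  have hDpsd : D.PosSemidef := Matrix.PosSemidef.diagonal hs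
  obtain ⟨y, hy⟩ : ∃ y, y = (Sig⁻¹ * D) *ᵥ b := ⟨_, rfl⟩
  have hSy : Sig *ᵥ y = D *ᵥ b := by
    rw [hy, mulVec_mulVec, ← mul_assoc, Matrix.mul_nonsing_inv _ hu, one_mul]
  have hV : b ⬝ᵥ ((2 : ℝ) • D - D * Sig⁻¹ * D) *ᵥ b = 2 * (b ⬝ᵥ D *ᵥ b) - y ⬝ᵥ D *ᵥ b := by
    rw [sub_mulVec, dotProduct_sub, smul_mulVec, dotProduct_smul, smul_eq_mul, mul_assoc,
      ← mulVec_mulVec, ← hy, gk_symm D hD b y]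
  rw [hV, ← hy]
  constructor
  · have h1 := hDpsd.dotProduct_mulVec_nonneg (y - (2:ℝ) • b)
    have h2 := hpsd.dotProduct_mulVec_nonneg y
    simp only [star_trivial, sub_mulVec, mulVec_sub, sub_dotProduct, dotProduct_sub, smul_mulVec,
      mulVec_smul, smul_dotProduct, dotProduct_smul, smul_eq_mul, hSy, gk_symm D hD b y] at h1 h2
    linarith
  · rw [mulVec_sub, hSy]
    simp only [dotProduct_sub, sub_dotProduct, gk_symm Sig hS y (a + b), hSy, add_dotProduct]
    ring

/-- Gaussian knockoffs: let `X ~ N(0, Σ)` with `Σ ≻ 0` and let `s ≥ 0`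
satisfy `2Σ - diag(s) ⪰ 0`.  If `X̃ | X ~ N(X - diag(s)Σ⁻¹X, 2diag(s) - diag(s)Σ⁻¹diag(s))`
(expressed via a Markov kernel `κ` whose one-dimensional projections are the stated
Gaussians, with the joint law of `(X, X̃)` equal to `law(X) ⊗ₘ κ`), then `(X, X̃)` is
jointly Gaussian with covariance `G = [[Σ, Σ-diag(s)],[Σ-diag(s), Σ]]` (every linear
functional is Gaussian with the corresponding variance), and `(X, X̃)_{swap(S)} =_d (X, X̃)`
for every `S ⊆ {1,…,p}`. -/
theorem gaussian_knockoff_construction {Ω : Type*} [mΩ : MeasurableSpace Ω]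
    (μ : Measure Ω) [IsProbabilityMeasure μ] (p : ℕ)
    (Sig : Matrix (Fin p) (Fin p) ℝ) (hSig : Sig.PosDef)
    (s : Fin p → ℝ) (hs : ∀ i, 0 ≤ s i)
    (hpsd : ((2 : ℝ) • Sig - Matrix.diagonal s).PosSemidef)
    (X Xt : Ω → Fin p → ℝ) (hX : Measurable X) (hXt : Measurable Xt)
    -- X ~ N(0, Σ): every linear functional of X is a centered Gaussian
    (hXmarg : ∀ a : Fin p → ℝ,
      Measure.map (fun ω => ∑ i, a i * X ω i) μ =
        gaussianReal 0 (Real.toNNReal (∑ i, ∑ j, a i * Sig i j * a j)))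
    -- the conditional law of X̃ given X is N(X - diag(s)Σ⁻¹X, 2diag(s) - diag(s)Σ⁻¹diag(s))
    (κ : Kernel (Fin p → ℝ) (Fin p → ℝ)) [IsMarkovKernel κ]
    (hκ : ∀ (x : Fin p → ℝ) (a : Fin p → ℝ),
      Measure.map (fun z => ∑ i, a i * z i) (κ x) =
        gaussianReal (∑ i, a i * (x i - ((Matrix.diagonal s * Sig⁻¹) *ᵥ x) i))
          (Real.toNNReal (∑ i, ∑ j, a i *
            ((2 : ℝ) • Matrix.diagonal s -
              Matrix.diagonal s * Sig⁻¹ * Matrix.diagonal s) i j * a j)))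
    (hjoint : Measure.map (fun ω => (X ω, Xt ω)) μ = (Measure.map X μ) ⊗ₘ κ) :
    (∀ a b : Fin p → ℝ,
      Measure.map (fun ω => ∑ i, a i * X ω i + ∑ i, b i * Xt ω i) μ =
        gaussianReal 0 (Real.toNNReal
          (∑ i, ∑ j, a i * Sig i j * a j +
            2 * ∑ i, ∑ j, a i * (Sig - Matrix.diagonal s) i j * b j +
            ∑ i, ∑ j, b i * Sig i j * b j))) ∧
    (∀ S : Finset (Fin p),
      Measure.map (fun ω =>
          ((fun j : Fin p => if j ∈ S then Xt ω j else X ω j),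
           (fun j : Fin p => if j ∈ S then X ω j else Xt ω j))) μ =
        Measure.map (fun ω => (X ω, Xt ω)) μ) := by
  have hS : Sigᵀ = Sig := by
    have h : Sigᴴ = Sig := hSig.1
    rwa [conjTranspose_eq_transpose_of_trivial] at h
  have key : (∀ a b : Fin p → ℝ,
      Measure.map (fun ω => ∑ i, a i * X ω i + ∑ i, b i * Xt ω i) μ =
        gaussianReal 0 (Real.toNNReal
          (∑ i, ∑ j, a i * Sig i j * a j +
            2 * ∑ i, ∑ j, a i * (Sig - Matrix.diagonal s) i j * b j +
            ∑ i, ∑ j, b i * Sig i j * b j))) := by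
    intro a b
    obtain ⟨hV0, hVeq⟩ := gk_V Sig hSig s hs hpsd a b
    rw [gk_quad Sig hS, ← hVeq]
    set c := a + b - (Sig⁻¹ * Matrix.diagonal s) *ᵥ b with hc
    set v := b ⬝ᵥ ((2 : ℝ) • Matrix.diagonal s -
              Matrix.diagonal s * Sig⁻¹ * Matrix.diagonal s) *ᵥ b with hv
    have hc0 : 0 ≤ c ⬝ᵥ Sig *ᵥ c := by
      simpa using hSig.posSemidef.dotProduct_mulVec_nonneg c
    have hmean : ∀ x : Fin p → ℝ, ∑ i, a i * x i +
        ∑ i, b i * (x i - ((Matrix.diagonal s * Sig⁻¹) *ᵥ x) i) = ∑ i, c i * x i := by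
      intro x
      have h1 : ∑ i, b i * (x i - ((Matrix.diagonal s * Sig⁻¹) *ᵥ x) i) =
        b ⬝ᵥ (x - (Matrix.diagonal s * Sig⁻¹) *ᵥ x) := rfl
      have h2 : ∑ i, c i * x i = c ⬝ᵥ x := rfl
      have h3 : ∑ i, a i * x i = a ⬝ᵥ x := rfl
      have hT : (Matrix.diagonal s * Sig⁻¹)ᵀ = Sig⁻¹ * Matrix.diagonal s := by
        rw [transpose_mul, transpose_nonsing_inv, hS, diagonal_transpose]
      rw [h1, h2, h3, hc, dotProduct_sub, dotProduct_mulVec, ← mulVec_transpose, hT,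
        sub_dotProduct, add_dotProduct]
      ring
    apply Measure.ext_of_charFun
    ext t
    have hm : Measurable (fun ω => ∑ i, a i * X ω i + ∑ i, b i * Xt ω i) := by fun_prop
    have hin : ∀ x : Fin p → ℝ,
        ∫ z, Complex.exp (t * ((∑ i, a i * x i + ∑ i, b i * z i : ℝ) : ℂ) * Complex.I) ∂(κ x) =
        Complex.exp (t * ((∑ i, c i * x i : ℝ) : ℂ) * Complex.I) *
          Complex.exp (-(v * t ^ 2 / 2)) := by
      intro x
      have h := congrArg (fun m => charFun m t) (hκ x b)
      simp only [charFun_gaussianReal, gk_dot] at h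
      rw [← hv, charFun_apply_real,
        integral_map (Measurable.aemeasurable (by fun_prop)) (by fun_prop),
        Real.coe_toNNReal _ hV0] at h
      have : ∀ z : Fin p → ℝ,
          Complex.exp (t * ((∑ i, a i * x i + ∑ i, b i * z i : ℝ) : ℂ) * Complex.I) =
          Complex.exp (t * ((∑ i, a i * x i : ℝ) : ℂ) * Complex.I) *
          Complex.exp (t * ((∑ i, b i * z i : ℝ) : ℂ) * Complex.I) := by
        intro z
        rw [← Complex.exp_add, Complex.ofReal_add]
        ring_nf
      simp_rw [this]
      rw [integral_const_mul, h, ← Complex.exp_add, ← Complex.exp_add, ← hmean x,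
        Complex.ofReal_add]
      ring_nf
    have hcm := congrArg (fun m => charFun m t) (hXmarg c)
    simp only [charFun_gaussianReal, gk_dot] at hcm
    rw [charFun_apply_real, integral_map (by fun_prop) (by fun_prop),
        Real.coe_toNNReal _ hc0] at hcm
    rw [charFun_apply_real, integral_map (by fun_prop) (by fun_prop), charFun_gaussianReal,
      Real.coe_toNNReal _ (by positivity)]
    have hF : Measurable (fun q : (Fin p → ℝ) × (Fin p → ℝ) =>
      Complex.exp (t * ((∑ i, a i * q.1 i + ∑ i, b i * q.2 i : ℝ) : ℂ) * Complex.I)) := by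
      fun_prop
    have e1 := integral_map (μ := μ) (hX.prodMk hXt).aemeasurable hF.aestronglyMeasurable
    simp only at e1
    haveI : IsProbabilityMeasure (Measure.map X μ) :=
      Measure.isProbabilityMeasure_map hX.aemeasurable
    rw [← e1, hjoint, Measure.integral_compProd]
    · simp only [hin]
      rw [integral_mul_const, integral_map (by fun_prop)
        (Measurable.aestronglyMeasurable (by fun_prop)), hcm, ← Complex.exp_add]
      push_cast
      ring_nf
    · apply Integrable.of_bound hF.aestronglyMeasurable 1
      refine Filter.Eventually.of_forall fun q => ?_
      rw [← Complex.ofReal_mul, Complex.norm_exp_ofReal_mul_I]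
  refine ⟨key, fun S => ?_⟩
  have hsw : Measurable (fun ω =>
          ((fun j : Fin p => if j ∈ S then Xt ω j else X ω j),
           (fun j : Fin p => if j ∈ S then X ω j else Xt ω j))) := by
    refine Measurable.prodMk ?_ ?_ <;> refine measurable_pi_lambda _ fun j => ?_ <;>
      split_ifs <;> fun_prop
  haveI := Measure.isProbabilityMeasure_map (μ := μ) hsw.aemeasurable
  haveI := Measure.isProbabilityMeasure_map (μ := μ) (hX.prodMk hXt).aemeasurable
  apply Measure.ext_of_charFunDual
  ext L
  rw [charFunDual_eq_charFun_map_one, charFunDual_eq_charFun_map_one,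
    Measure.map_map (by fun_prop) hsw, Measure.map_map (by fun_prop) (hX.prodMk hXt)]
  congr 1
  obtain ⟨a, b, hab⟩ : ∃ a b : Fin p → ℝ, ∀ x y, L (x, y) = ∑ i, a i * x i + ∑ i, b i * y i := by
    refine ⟨fun i => L (Pi.single i 1, 0), fun i => L (0, Pi.single i 1), fun x y => ?_⟩
    have h1 : L (x, y) = (L.comp (ContinuousLinearMap.inl ℝ _ _)) x +
        (L.comp (ContinuousLinearMap.inr ℝ _ _)) y := by
      simp [← map_add]
    rw [h1]
    congr 1
    · conv_lhs => rw [pi_eq_sum_univ' x, map_sum]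
      refine Finset.sum_congr rfl fun i _ => ?_
      rw [map_smul, smul_eq_mul, mul_comm]
      simp
    · conv_lhs => rw [pi_eq_sum_univ' y, map_sum]
      refine Finset.sum_congr rfl fun i _ => ?_
      rw [map_smul, smul_eq_mul, mul_comm]
      simp
  have k1 := key a b
  have k2 := key (fun j => if j ∈ S then b j else a j) (fun j => if j ∈ S then a j else b j)
  rw [gk_quad Sig hS] at k1 k2
  have e1 : ((fun j => if j ∈ S then b j else a j) + (fun j => if j ∈ S then a j else b j)) =
      a + b := by
    funext j
    simp only [Pi.add_apply]
    split_ifs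
    · exact add_comm _ _
    · rfl
  have e2 : (fun j => if j ∈ S then b j else a j) ⬝ᵥ Matrix.diagonal s *ᵥ
      (fun j => if j ∈ S then a j else b j) = a ⬝ᵥ Matrix.diagonal s *ᵥ b := by
    simp only [dotProduct, mulVec_diagonal]
    refine Finset.sum_congr rfl fun j _ => ?_
    split_ifs <;> ring
  rw [e1, e2, ← k1] at k2
  convert k2 using 2
  · funext ω
    simp only [Function.comp, hab, ← Finset.sum_add_distrib]
    refine Finset.sum_congr rfl fun j _ => ?_
    split_ifs <;> ring
  · funext ω
    simp only [Function.comp, hab]
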